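/- Any two-color Babylon position consisting of 4 red singleton stacks, k blue singleton stacks with k ≥ 4 even (so the total number of stacks, k+5, is odd), no red stack of height ≥ 2, and exactly one blue stack of height 2v with v ≥ 1, is a first-player win; that is, the player to move wins with best play. -/

import Mathlib

/-- A chip color: `true` = red, `false` = blue.  A stack is a nonempty list of
chips, the head of the list being the top chip; the color of a stack is the
color of its top chip.  A position is a finite multiset of stacks. -/
abbrev Stack := List Bool

abbrev Position := Multiset Stack

/-- A legal move replaces two stacks `s` and `t` that have equal length or
equal top color by the single concatenated stack `s ++ t`. -/
def Move (P Q : Position) : Prop :=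
  ∃ s t : Stack, s ≠ [] ∧ t ≠ [] ∧ s ∈ P ∧ t ∈ P.erase s ∧
    (s.length = t.length ∨ s.head? = t.head?) ∧
    Q = (s ++ t) ::ₘ (P.erase s).erase t

/-- Auxiliary predicate, with the number of stacks as fuel: the player to move
wins iff there is a legal move to a position that is not a first-player win. -/
def FirstWinAux : ℕ → Position → Prop
  | 0, _ => False
  | n + 1, P => ∃ Q, Move P Q ∧ ¬ FirstWinAux n Q

/-- The position is a first-player win: the player to move has a winning
strategy.  Since each move decreases the number of stacks by exactly one,
`Multiset.card P` is enough fuel. -/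
def FirstWin (P : Position) : Prop := FirstWinAux (Multiset.card P) P

/-- The initial position with `p` red singleton stacks and `q` blue
singleton stacks. -/
def initPos (p q : ℕ) : Position :=
  Multiset.replicate p [true] + Multiset.replicate q [false]

/-- `Merge C D`: the multiset of heights `D` arises from `C` by adding two of its entries. -/
def Merge (C D : Multiset ℕ) : Prop :=
  ∃ (a b : ℕ) (E : Multiset ℕ), C = a ::ₘ b ::ₘ E ∧ D = (a + b) ::ₘ E

/-- A move in terms of the heights `R` of the red stacks and `B` of the blue stacks. -/
inductive Step : Multiset ℕ → Multiset ℕ → Multiset ℕ → Multiset ℕ → Prop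
  | red {R R' : Multiset ℕ} (B : Multiset ℕ) : Merge R R' → Step R B R' B
  | blue (R : Multiset ℕ) {B B' : Multiset ℕ} : Merge B B' → Step R B R B'
  | redOver (a : ℕ) (R B : Multiset ℕ) : Step (a ::ₘ R) (a ::ₘ B) ((a + a) ::ₘ R) B
  | blueOver (a : ℕ) (R B : Multiset ℕ) : Step (a ::ₘ R) (a ::ₘ B) R ((a + a) ::ₘ B)

mutual
/-- Alice, to move, wins. -/
inductive AliceWins : Multiset ℕ → Multiset ℕ → Prop
  | intro {R B R' B' : Multiset ℕ} : Step R B R' B' → BobLoses R' B' → AliceWins R B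
/-- Bob, to move, loses. -/
inductive BobLoses : Multiset ℕ → Multiset ℕ → Prop
  | intro {R B : Multiset ℕ} : (∀ R' B', Step R B R' B' → AliceWins R' B') → BobLoses R B
end

/-! ### Reduction to heights -/

/-- The heights of the stacks of color `c`. -/
def heights (c : Bool) (P : Position) : Multiset ℕ :=
  (P.filter fun s => s.head? = some c).map List.length

theorem heights_cons_self {c : Bool} {s : Stack} (P : Position) (h : s.head? = some c) :
    heights c (s ::ₘ P) = s.length ::ₘ heights c P := by
  simp [heights, h]

theorem heights_cons_ne {c : Bool} {s : Stack} (P : Position) (h : s.head? ≠ some c) :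
    heights c (s ::ₘ P) = heights c P := by
  simp [heights, h]

theorem exists_cons_of_heights {c : Bool} {P : Position} {a : ℕ} {D : Multiset ℕ}
    (h : heights c P = a ::ₘ D) :
    ∃ s P', P = s ::ₘ P' ∧ s.head? = some c ∧ s.length = a ∧ heights c P' = D := by
  have ha : a ∈ heights c P := by rw [h]; exact Multiset.mem_cons_self a D
  obtain ⟨s, hs, rfl⟩ := Multiset.mem_map.1 ha
  obtain ⟨hsP, hc⟩ := Multiset.mem_filter.1 hs
  obtain ⟨P', rfl⟩ := Multiset.exists_cons_of_mem hsP
  rw [heights_cons_self P' hc, Multiset.cons_inj_right] at h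
  exact ⟨s, P', rfl, hc, rfl, h⟩

theorem move_iff {P Q : Position} :
    Move P Q ↔ ∃ s t P', s ≠ [] ∧ t ≠ [] ∧ (s.length = t.length ∨ s.head? = t.head?) ∧
      P = s ::ₘ t ::ₘ P' ∧ Q = (s ++ t) ::ₘ P' := by
  constructor
  · rintro ⟨s, t, hs, ht, hsP, htP, h, rfl⟩
    exact ⟨s, t, _, hs, ht, h, by rw [Multiset.cons_erase htP, Multiset.cons_erase hsP], rfl⟩
  · rintro ⟨s, t, P', hs, ht, h, rfl, rfl⟩
    exact ⟨s, t, hs, ht, by simp, by simp, h, by simp⟩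

theorem head?_append_of_eq {s t : Stack} {c : Bool} (h : s.head? = some c) :
    (s ++ t).head? = some c := by
  simp [h]

theorem Move.step {P Q : Position} (h : Move P Q) :
    Step (heights true P) (heights false P) (heights true Q) (heights false Q) := by
  obtain ⟨s, t, P', hs, ht, hst, rfl, rfl⟩ := move_iff.1 h
  obtain ⟨c, hc⟩ : ∃ c, s.head? = some c := ⟨_, List.head?_eq_some_head hs⟩
  obtain ⟨d, hd⟩ : ∃ d, t.head? = some d := ⟨_, List.head?_eq_some_head ht⟩
  have hsa := head?_append_of_eq (t := t) hc
  cases c <;> cases d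
  · simp only [heights_cons_self _ hc, heights_cons_self _ hd, heights_cons_self _ hsa,
      heights_cons_ne (c := true) _ (by simp [hc] : s.head? ≠ some true),
      heights_cons_ne (c := true) _ (by simp [hd] : t.head? ≠ some true),
      heights_cons_ne (c := true) _ (by simp [hsa] : (s ++ t).head? ≠ some true)]
    exact .blue _ ⟨_, _, _, rfl, by simp⟩
  · have hl : s.length = t.length := by simpa [hc, hd] using hst
    simp only [heights_cons_self _ hc, heights_cons_self _ hd, heights_cons_self _ hsa,
      heights_cons_ne (c := true) _ (by simp [hc] : s.head? ≠ some true),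
      heights_cons_ne (c := false) _ (by simp [hd] : t.head? ≠ some false),
      heights_cons_ne (c := true) _ (by simp [hsa] : (s ++ t).head? ≠ some true),
      List.length_append, hl]
    exact .blueOver _ _ _
  · have hl : s.length = t.length := by simpa [hc, hd] using hst
    simp only [heights_cons_self _ hc, heights_cons_self _ hd, heights_cons_self _ hsa,
      heights_cons_ne (c := false) _ (by simp [hc] : s.head? ≠ some false),
      heights_cons_ne (c := true) _ (by simp [hd] : t.head? ≠ some true),
      heights_cons_ne (c := false) _ (by simp [hsa] : (s ++ t).head? ≠ some false),
      List.length_append, hl]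
    exact .redOver _ _ _
  · simp only [heights_cons_self _ hc, heights_cons_self _ hd, heights_cons_self _ hsa,
      heights_cons_ne (c := false) _ (by simp [hc] : s.head? ≠ some false),
      heights_cons_ne (c := false) _ (by simp [hd] : t.head? ≠ some false),
      heights_cons_ne (c := false) _ (by simp [hsa] : (s ++ t).head? ≠ some false)]
    exact .red _ ⟨_, _, _, rfl, by simp⟩

theorem exists_move_of_merge {c d : Bool} (hcd : c ≠ d) {P : Position} {C : Multiset ℕ}
    (h : Merge (heights c P) C) :
    ∃ Q, Move P Q ∧ heights c Q = C ∧ heights d Q = heights d P := by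
  obtain ⟨a, b, E, hE, rfl⟩ := h
  obtain ⟨s, P₁, rfl, hs, rfl, hP₁⟩ := exists_cons_of_heights hE
  obtain ⟨t, P', rfl, ht, rfl, rfl⟩ := exists_cons_of_heights hP₁
  have hsa := head?_append_of_eq (t := t) hs
  refine ⟨(s ++ t) ::ₘ P', move_iff.2 ⟨s, t, P', ?_, ?_, .inr (hs.trans ht.symm), rfl, rfl⟩,
    ?_, ?_⟩
  · rintro rfl; simp at hs
  · rintro rfl; simp at ht
  · simp [heights_cons_self _ hsa]
  · simp only [heights_cons_ne (c := d) _ (by simp [hs, hcd] : s.head? ≠ some d),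
      heights_cons_ne (c := d) _ (by simp [ht, hcd] : t.head? ≠ some d),
      heights_cons_ne (c := d) _ (by rw [hsa]; simp [hcd] : (s ++ t).head? ≠ some d)]

theorem exists_move_over {c d : Bool} (hcd : c ≠ d) {P : Position} {a : ℕ} {C D : Multiset ℕ}
    (hC : heights c P = a ::ₘ C) (hD : heights d P = a ::ₘ D) :
    ∃ Q, Move P Q ∧ heights c Q = (a + a) ::ₘ C ∧ heights d Q = D := by
  obtain ⟨s, P₁, rfl, hs, rfl, rfl⟩ := exists_cons_of_heights hC
  rw [heights_cons_ne (c := d) _ (by simp [hs, hcd] : s.head? ≠ some d)] at hD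
  obtain ⟨t, P', rfl, ht, hl, rfl⟩ := exists_cons_of_heights hD
  have hsa := head?_append_of_eq (t := t) hs
  refine ⟨(s ++ t) ::ₘ P', move_iff.2 ⟨s, t, P', ?_, ?_, .inl hl.symm, rfl, rfl⟩, ?_, ?_⟩
  · rintro rfl; simp at hs
  · rintro rfl; simp at ht
  · simp [heights_cons_self _ hsa, hl,
      heights_cons_ne (c := c) _ (by simp [ht, hcd.symm] : t.head? ≠ some c)]
  · rw [heights_cons_ne (c := d) _ (by rw [hsa]; simp [hcd] : (s ++ t).head? ≠ some d)]

theorem exists_move_of_step {P : Position} {R B : Multiset ℕ}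
    (h : Step (heights true P) (heights false P) R B) :
    ∃ Q, Move P Q ∧ heights true Q = R ∧ heights false Q = B := by
  generalize hR : heights true P = R₀ at h
  generalize hB : heights false P = B₀ at h
  cases h with
  | red _ hm =>
    subst hR hB
    exact exists_move_of_merge (by simp) hm
  | blue _ hm =>
    subst hR hB
    obtain ⟨Q, h₁, h₂, h₃⟩ := exists_move_of_merge (d := true) (by simp) hm
    exact ⟨Q, h₁, h₃, h₂⟩
  | redOver a R B => exact exists_move_over (by simp) hR hB
  | blueOver a R B =>
    obtain ⟨Q, h₁, h₂, h₃⟩ := exists_move_over (by simp) hB hR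
    exact ⟨Q, h₁, h₃, h₂⟩

theorem Move.card {P Q : Position} (h : Move P Q) : P.card = Q.card + 1 := by
  obtain ⟨s, t, P', -, -, -, rfl, rfl⟩ := move_iff.1 h
  simp

theorem firstWinAux_of_heights (n : ℕ) : ∀ P : Position, P.card ≤ n →
    (AliceWins (heights true P) (heights false P) → FirstWinAux n P) ∧
    (BobLoses (heights true P) (heights false P) → ¬ FirstWinAux n P) := by
  induction n with
  | zero =>
    refine fun P hP => ⟨fun ⟨hs, _⟩ => ?_, fun _ h => h⟩
    obtain ⟨Q, hm, -⟩ := exists_move_of_step hs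
    have := hm.card
    omega
  | succ n ih =>
    refine fun P hP => ⟨fun ⟨hs, hb⟩ => ?_, fun ⟨hb⟩ ⟨Q, hm, hQ⟩ => ?_⟩
    · obtain ⟨Q, hm, rfl, rfl⟩ := exists_move_of_step hs
      have := hm.card
      exact ⟨Q, hm, (ih Q (by omega)).2 hb⟩
    · have := hm.card
      exact hQ ((ih Q (by omega)).1 (hb _ _ hm.step))

/-! ### Moves on heights -/

theorem Merge.card {C D : Multiset ℕ} (h : Merge C D) : C.card = D.card + 1 := by
  obtain ⟨a, b, E, rfl, rfl⟩ := h
  simp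

theorem Merge.sum {C D : Multiset ℕ} (h : Merge C D) : D.sum = C.sum := by
  obtain ⟨a, b, E, rfl, rfl⟩ := h
  simp [add_assoc]

theorem Merge.of_cons {x : ℕ} {C D : Multiset ℕ} (h : Merge (x ::ₘ C) D) :
    (∃ y E, C = y ::ₘ E ∧ D = (x + y) ::ₘ E) ∨ ∃ E, Merge C E ∧ D = x ::ₘ E := by
  obtain ⟨a, b, E, h, rfl⟩ := h
  rcases Multiset.cons_eq_cons.1 h with ⟨rfl, rfl⟩ | ⟨-, F, rfl, hF⟩
  · exact .inl ⟨b, E, rfl, rfl⟩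
  · rcases Multiset.cons_eq_cons.1 hF with ⟨rfl, rfl⟩ | ⟨-, G, rfl, rfl⟩
    · exact .inl ⟨a, E, rfl, by rw [add_comm]⟩
    · exact .inr ⟨(a + b) ::ₘ G, ⟨a, b, G, rfl, rfl⟩, Multiset.cons_swap _ _ _⟩

theorem not_merge_singleton {a : ℕ} {D : Multiset ℕ} : ¬ Merge {a} D := by
  rintro ⟨b, c, E, h, -⟩
  simpa using congrArg Multiset.card h

theorem Merge.of_pair {a b : ℕ} {D : Multiset ℕ} (h : Merge {a, b} D) : D = {a + b} := by
  rcases Merge.of_cons h with ⟨y, E, hE, rfl⟩ | ⟨E, hE, -⟩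
  · obtain ⟨rfl, rfl⟩ := (Multiset.singleton_eq_cons_iff _).1 hE
    rfl
  · exact absurd hE not_merge_singleton

theorem Merge.of_triple {a b c : ℕ} {D : Multiset ℕ} (h : Merge {a, b, c} D) :
    D = {a + b, c} ∨ D = {a + c, b} ∨ D = {a, b + c} := by
  rcases Merge.of_cons h with ⟨y, E, hE, rfl⟩ | ⟨E, hE, rfl⟩
  · rcases Multiset.cons_eq_cons.1 hE with ⟨rfl, rfl⟩ | ⟨-, F, hF, rfl⟩
    · exact .inl rfl
    · obtain ⟨rfl, rfl⟩ := (Multiset.singleton_eq_cons_iff _).1 hF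
      exact .inr (.inl rfl)
  · rw [hE.of_pair]
    exact .inr (.inr rfl)

theorem Merge.of_replicate_one {m : ℕ} {D : Multiset ℕ} (h : Merge (.replicate m 1) D) :
    ∃ j, m = j + 2 ∧ D = 2 ::ₘ .replicate j 1 := by
  obtain ⟨a, b, E, h, rfl⟩ := h
  have hall : ∀ x ∈ a ::ₘ b ::ₘ E, x = 1 := fun x hx =>
    Multiset.eq_of_mem_replicate (h ▸ hx)
  have hcard := congrArg Multiset.card h
  simp only [Multiset.card_replicate, Multiset.card_cons] at hcard
  refine ⟨E.card, by omega, ?_⟩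
  rw [hall a (by simp), hall b (by simp),
    Multiset.eq_replicate_card (s := E) |>.2 fun x hx => hall x (by simp [hx])]
  simp

theorem Merge.of_cons_replicate_one {x m : ℕ} {D : Multiset ℕ}
    (h : Merge (x ::ₘ .replicate m 1) D) :
    (∃ j, m = j + 1 ∧ D = (x + 1) ::ₘ .replicate j 1) ∨
      ∃ j, m = j + 2 ∧ D = 2 ::ₘ x ::ₘ .replicate j 1 := by
  rcases h.of_cons with ⟨y, E, hE, rfl⟩ | ⟨E, hE, rfl⟩
  · have hall : ∀ z ∈ y ::ₘ E, z = 1 := fun z hz => Multiset.eq_of_mem_replicate (hE ▸ hz)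
    have hcard := congrArg Multiset.card hE
    simp only [Multiset.card_replicate, Multiset.card_cons] at hcard
    refine .inl ⟨E.card, hcard, ?_⟩
    rw [hall y (by simp),
      Multiset.eq_replicate_card (s := E) |>.2 fun z hz => hall z (by simp [hz])]
    simp
  · obtain ⟨j, rfl, rfl⟩ := hE.of_replicate_one
    exact .inr ⟨j, rfl, Multiset.cons_swap _ _ _⟩

theorem BobLoses.of_moves {R B : Multiset ℕ} (hR : ∀ R', Merge R R' → AliceWins R' B)
    (hB : ∀ B', Merge B B' → AliceWins R B')
    (hover : ∀ a ∈ R, a ∈ B → AliceWins ((a + a) ::ₘ R.erase a) (B.erase a) ∧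
      AliceWins (R.erase a) ((a + a) ::ₘ B.erase a)) : BobLoses R B := by
  refine .intro fun R' B' h => ?_
  cases h with
  | red _ h => exact hR _ h
  | blue _ h => exact hB _ h
  | redOver a R B => simpa using (hover a (by simp) (by simp)).1
  | blueOver a R B => simpa using (hover a (by simp) (by simp)).2

theorem AliceWins.red {R B : Multiset ℕ} (a b : ℕ) (D : Multiset ℕ) (hR : R = a ::ₘ b ::ₘ D)
    (h : BobLoses ((a + b) ::ₘ D) B) : AliceWins R B :=
  .intro (.red _ ⟨a, b, D, hR, rfl⟩) h

theorem AliceWins.blue {R B : Multiset ℕ} (a b : ℕ) (D : Multiset ℕ) (hB : B = a ::ₘ b ::ₘ D)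
    (h : BobLoses R ((a + b) ::ₘ D)) : AliceWins R B :=
  .intro (.blue _ ⟨a, b, D, hB, rfl⟩) h

theorem AliceWins.redOver {R B : Multiset ℕ} (a : ℕ) (D E : Multiset ℕ) (hR : R = a ::ₘ D)
    (hB : B = a ::ₘ E) (h : BobLoses ((a + a) ::ₘ D) E) : AliceWins R B := by
  subst hR hB
  exact .intro (.redOver a D E) h

theorem AliceWins.blueOver {R B : Multiset ℕ} (a : ℕ) (D E : Multiset ℕ) (hR : R = a ::ₘ D)
    (hB : B = a ::ₘ E) (h : BobLoses D ((a + a) ::ₘ E)) : AliceWins R B := by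
  subst hR hB
  exact .intro (.blueOver a D E) h

/-! ### Positions with one or two red stacks -/

/-- A condition, stable under blue merges, which allows Alice to prevent the blue stacks from
matching a red stack of height `h`. -/
def Safe (h : ℕ) (B : Multiset ℕ) : Prop :=
  B.sum ≠ h ∧ (Odd h ∨ B.sum < h ∨ ∃ x ∈ B, h < 2 * x) ∧ ∀ x ∈ B, 0 < x

theorem Safe.merge {h : ℕ} {B C : Multiset ℕ} (hs : Safe h B) (hm : Merge B C) : Safe h C := by
  have hsum := hm.sum
  obtain ⟨a, b, E, rfl, rfl⟩ := hm
  obtain ⟨h₁, h₂, h₃⟩ := hs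
  simp only [Multiset.mem_cons, forall_eq_or_imp, exists_eq_or_imp] at h₂ h₃
  refine ⟨hsum ▸ h₁, ?_, ?_⟩
  · rw [hsum]
    simp only [Multiset.mem_cons, exists_eq_or_imp]
    rcases h₂ with h₂ | h₂ | h₂ | h₂ | h₂
    · exact .inl h₂
    · exact .inr (.inl h₂)
    · exact .inr (.inr (.inl (by omega)))
    · exact .inr (.inr (.inl (by omega)))
    · exact .inr (.inr (.inr h₂))
  · simp only [Multiset.mem_cons, forall_eq_or_imp]
    exact ⟨by omega, h₃.2.2⟩

theorem exists_cons_of_card_pos {C : Multiset ℕ} (h : 0 < C.card) : ∃ a D, C = a ::ₘ D := by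
  obtain ⟨a, ha⟩ := Multiset.card_pos_iff_exists_mem.1 h
  exact ⟨a, Multiset.exists_cons_of_mem ha⟩

theorem Safe.exists_pair {h : ℕ} {B : Multiset ℕ} (hs : Safe h B) (hc : 2 ≤ B.card) :
    ∃ a b D, B = a ::ₘ b ::ₘ D ∧ a + b ≠ h := by
  by_contra! hcon
  have key : ∀ x ∈ B, 2 * x = h := by
    intro x hx
    obtain ⟨C, rfl⟩ := Multiset.exists_cons_of_mem hx
    rw [Multiset.card_cons] at hc
    obtain ⟨y, D, rfl⟩ := exists_cons_of_card_pos (C := C) (by omega)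
    have hxy := hcon x y D rfl
    rcases Nat.eq_zero_or_pos D.card with hD | hD
    · rw [Multiset.card_eq_zero] at hD
      exact absurd (by simpa [hD] using hxy) hs.1
    · obtain ⟨z, E, rfl⟩ := exists_cons_of_card_pos hD
      have hxz := hcon x z (y ::ₘ E) (by rw [Multiset.cons_swap y z])
      have hyz := hcon y z (x ::ₘ E) (by rw [Multiset.cons_swap x y, Multiset.cons_swap x z])
      omega
  obtain ⟨a, C, rfl⟩ := exists_cons_of_card_pos (C := B) (by omega)
  rw [Multiset.card_cons] at hc
  obtain ⟨b, D, rfl⟩ := exists_cons_of_card_pos (C := C) (by omega)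
  rcases hs.2.1 with ho | hlt | ⟨x, hx, hlt⟩
  · have := key a (by simp)
    obtain ⟨t, rfl⟩ := ho
    omega
  · have := hcon a b D rfl
    simp only [Multiset.sum_cons] at hlt
    omega
  · have := key x hx
    omega

theorem aliceWins_singleton_step {h n : ℕ} {c : ℕ} {D : Multiset ℕ}
    (ih : ∀ B : Multiset ℕ, B.card = 2 * n + 1 → Safe h B → h ∉ B → BobLoses {h} B)
    (hc : (c ::ₘ D).card = 2 * n + 2) (hs : Safe h (c ::ₘ D)) (hD : h ∉ D) :
    AliceWins {h} (c ::ₘ D) := by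
  obtain ⟨a, b, E, hE, hab, hnE⟩ :
      ∃ a b E, c ::ₘ D = a ::ₘ b ::ₘ E ∧ h ≠ a + b ∧ h ∉ E := by
    by_cases hch : c = h
    · subst hch
      rw [Multiset.card_cons] at hc
      obtain ⟨y, E, rfl⟩ := exists_cons_of_card_pos (C := D) (by omega)
      have := hs.2.2 y (by simp)
      exact ⟨c, y, E, rfl, by omega, fun hx => hD (by simp [hx])⟩
    · obtain ⟨a, b, E, hE, hab⟩ := hs.exists_pair (by omega)
      have hn : h ∉ c ::ₘ D := by simp [hD, Ne.symm hch]
      rw [hE] at hn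
      exact ⟨a, b, E, hE, hab.symm, fun hx => hn (by simp [hx])⟩
  have hm : Merge (c ::ₘ D) ((a + b) ::ₘ E) := ⟨a, b, E, hE, rfl⟩
  have := hm.card
  exact .blue a b E hE (ih _ (by omega) (hs.merge hm) (by simp [hab, hnE]))

theorem bobLoses_singleton {h : ℕ} (n : ℕ) : ∀ B : Multiset ℕ, B.card = 2 * n + 1 →
    Safe h B → h ∉ B → BobLoses {h} B := by
  induction n with
  | zero =>
    refine fun B hB hs hn => .of_moves (fun _ hR => absurd hR not_merge_singleton)
      (fun B' hm => ?_) (fun a ha haB => ?_)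
    · obtain ⟨b, rfl⟩ := Multiset.card_eq_one.1 hB
      exact absurd hm not_merge_singleton
    · rw [Multiset.mem_singleton] at ha
      exact absurd (ha ▸ haB) hn
  | succ n ih =>
    refine fun B hB hs hn => .of_moves (fun _ hR => absurd hR not_merge_singleton)
      (fun B' hm => ?_) (fun a ha haB => ?_)
    · have hc := hm.card
      have hs' := hs.merge hm
      obtain ⟨a, b, E, rfl, rfl⟩ := hm
      exact aliceWins_singleton_step ih (by omega) hs' fun hx => hn (by simp [hx])
    · rw [Multiset.mem_singleton] at ha
      exact absurd (ha ▸ haB) hn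

theorem aliceWins_singleton {h c : ℕ} {D : Multiset ℕ} (hc : Odd D.card)
    (hs : Safe h (c ::ₘ D)) (hD : h ∉ D) : AliceWins {h} (c ::ₘ D) := by
  obtain ⟨n, hn⟩ := hc
  exact aliceWins_singleton_step (bobLoses_singleton n) (by simp [hn]) hs hD

theorem bobLoses_pair {a b : ℕ} (ha : 0 < a) (hb : 0 < b) (n : ℕ) : ∀ B : Multiset ℕ,
    B.card = 2 * n + 2 → Safe (a + b) B → a ∉ B → b ∉ B → a + b ∉ B → BobLoses {a, b} B := by
  induction n with
  | zero | succ n ih =>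
  all_goals
    refine fun B hB hs haB hbB habB => .of_moves (fun R' hR => ?_) (fun B' hm => ?_)
      (fun x hx hxB => ?_)
    · rw [hR.of_pair]
      obtain ⟨c, D, rfl⟩ := exists_cons_of_card_pos (C := B) (by omega)
      rw [Multiset.card_cons] at hB
      exact aliceWins_singleton (Nat.odd_iff.2 (by omega)) hs fun hx => habB (by simp [hx])
    · have hc := hm.card
      have hs' := hs.merge hm
      by_cases hab : a + b ∈ B'
      · obtain ⟨x, y, E, rfl, rfl⟩ := hm
        simp only [Multiset.mem_cons, not_or] at haB hbB habB hab
        have hxy : a + b = x + y := by tauto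
        rw [Multiset.card_cons] at hc
        rw [Multiset.card_cons] at hc
        rcases Nat.eq_zero_or_pos E.card with hE | hE
        · rw [Multiset.card_eq_zero] at hE
          exact absurd (by simp [hE, hxy]) hs'.1
        · obtain ⟨z, F, rfl⟩ := exists_cons_of_card_pos hE
          have hm' : Merge ((x + y) ::ₘ z ::ₘ F) ((x + y + z) ::ₘ F) := ⟨_, _, _, rfl, rfl⟩
          have hz := hs'.2.2 z (by simp)
          simp only [Multiset.mem_cons, not_or] at haB hbB habB
          refine .blue _ _ _ rfl ?_
          first
          | refine ih _ ?_ (hs'.merge hm') ?_ ?_ ?_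
            · simp only [Multiset.card_cons] at hB ⊢
              omega
            all_goals
              simp only [Multiset.mem_cons, not_or]
              refine ⟨by omega, by tauto⟩
          | simp only [Multiset.card_cons] at hB
            omega
      · exact .red a b 0 rfl (bobLoses_singleton (n := B'.card / 2) _ (by omega) hs' hab)
    · simp only [Multiset.insert_eq_cons, Multiset.mem_cons, Multiset.mem_singleton] at hx
      rcases hx with rfl | rfl <;> contradiction

/-! ### The strategy -/

@[simp]
theorem forall_mem_replicate_one (m : ℕ) (p : ℕ → Prop) :
    (∀ x ∈ Multiset.replicate m 1, p x) ↔ m = 0 ∨ p 1 := by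
  simp [Multiset.mem_replicate, or_iff_not_imp_left]

@[simp]
theorem notMem_replicate_one {a m : ℕ} (ha : a ≠ 1) : a ∉ Multiset.replicate m 1 :=
  fun h => ha (Multiset.eq_of_mem_replicate h)

theorem erase_one_cons_replicate {x m : ℕ} (hx : x ≠ 1) :
    (x ::ₘ Multiset.replicate (m + 1) 1).erase 1 = x ::ₘ .replicate m 1 := by
  rw [Multiset.erase_cons_tail _ hx, Multiset.replicate_succ, Multiset.erase_cons_head]

theorem bobLoses_three (n v : ℕ) (hv : 1 ≤ v) :
    BobLoses {3} (2 ::ₘ (2 * v) ::ₘ .replicate (2 * n + 1) 1) := by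
  refine bobLoses_singleton (n + 1) _ (by simp; omega)
    ⟨by simp; omega, .inl (by decide), ?_⟩ ?_
  · simp; omega
  · simp; omega

theorem bobLoses_two_two (n v : ℕ) (hv : 1 ≤ v) (h : 6 ≤ 2 * n + 2 + 2 * v) :
    BobLoses {2, 2} ((2 * v + 1) ::ₘ .replicate (2 * n + 1) 1) := by
  refine bobLoses_pair (by simp) (by simp) n _ (by simp)
    ⟨by simp; omega, .inr (.inr ⟨2 * v + 1, by simp, by omega⟩), ?_⟩ ?_ ?_ ?_
  · simp
  all_goals simp <;> omega

theorem bobLoses_six (n : ℕ) : BobLoses {6} (2 ::ₘ .replicate (2 * n + 6) 1) := by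
  have key : BobLoses {6} (4 ::ₘ .replicate (2 * n + 4) 1) :=
    bobLoses_singleton (n + 2) _ (by simp; omega)
      ⟨by simp; omega, .inr (.inr ⟨4, by simp, by omega⟩), by simp⟩ (by simp)
  refine .of_moves (fun _ hR => absurd hR not_merge_singleton) (fun B' hB => ?_) (by simp)
  rcases hB.of_cons_replicate_one with ⟨j, hj, rfl⟩ | ⟨j, hj, rfl⟩
  · obtain rfl : j = 2 * n + 5 := by omega
    exact .blue 3 1 (.replicate (2 * n + 4) 1) (by simp [Multiset.replicate_succ]) key
  · obtain rfl : j = 2 * n + 4 := by omega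
    exact .blue 2 2 _ rfl key

theorem aliceWins_two_four (n : ℕ) : AliceWins {2, 4} (2 ::ₘ .replicate (2 * n + 4) 1) := by
  rcases n with _ | n
  · refine .redOver 2 {4} (.replicate 4 1) rfl rfl ?_
    exact bobLoses_pair (by simp) (by simp) 1 _ (by simp)
      ⟨by simp, .inr (.inl (by simp)), by simp⟩ (by simp) (by simp) (by simp)
  · exact .red 2 4 0 rfl (bobLoses_six n)

theorem bobLoses_one_four (n : ℕ) : BobLoses {1, 4} (2 ::ₘ .replicate (2 * n + 5) 1) := by
  have hsafe : Safe 5 (2 ::ₘ .replicate (2 * n + 5) 1) :=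
    ⟨by simp; omega, .inl (by decide), by simp⟩
  refine .of_moves (fun R' hR => ?_) (fun B' hB => ?_) (fun a ha haB => ?_)
  · rw [hR.of_pair]
    exact aliceWins_singleton (by simp [Nat.odd_iff]; omega) hsafe (by simp)
  · have hs := hsafe.merge hB
    have hc := hB.card
    refine .red 1 4 0 rfl (bobLoses_singleton (n + 2) _ ?_ hs ?_)
    · simp only [Multiset.card_cons, Multiset.card_replicate] at hc
      omega
    · rcases hB.of_cons_replicate_one with ⟨j, hj, rfl⟩ | ⟨j, hj, rfl⟩ <;> simp
  · obtain rfl : a = 1 := by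
      simp [Multiset.mem_replicate] at ha haB
      omega
    rw [erase_one_cons_replicate (by simp)]
    refine ⟨aliceWins_two_four n, ?_⟩
    refine .blue 2 1 (2 ::ₘ .replicate (2 * n + 3) 1) ?_ ?_
    · simp [Multiset.replicate_succ, Multiset.cons_swap]
    · exact bobLoses_singleton (n + 2) _ (by simp; omega)
        ⟨by simp; omega, .inr (.inr ⟨3, by simp, by omega⟩), by simp⟩ (by simp)

theorem bobLoses_one_two_four : BobLoses {1, 2, 4} (.replicate 3 1) := by
  have h₇ : BobLoses {7} (.replicate 3 1) :=
    bobLoses_singleton 1 _ (by simp) ⟨by simp, .inl (by decide), by simp⟩ (by simp)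
  refine .of_moves (fun R' hR => ?_) (fun B' hB => ?_) (fun a ha haB => ?_)
  · rcases hR.of_triple with rfl | rfl | rfl
    · exact .red 3 4 0 rfl h₇
    · exact .red 5 2 0 rfl h₇
    · exact .red 1 6 0 rfl h₇
  · obtain ⟨j, hj, rfl⟩ := hB.of_replicate_one
    obtain rfl : j = 1 := by omega
    refine .red 1 2 {4} rfl ?_
    exact bobLoses_pair (by simp) (by simp) 0 _ (by simp)
      ⟨by simp, .inl (by decide), by simp⟩ (by simp) (by simp) (by simp)
  · obtain rfl := Multiset.eq_of_mem_replicate haB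
    constructor
    · refine .red 2 2 {4} (by decide) ?_
      exact bobLoses_pair (by simp) (by simp) 0 (.replicate 2 1) (by simp)
        ⟨by simp, .inr (.inl (by simp)), by simp⟩ (by simp) (by simp) (by simp)
    · refine .red 2 4 0 (by decide) ?_
      exact bobLoses_singleton 1 (2 ::ₘ .replicate 2 1) (by simp)
        ⟨by simp, .inr (.inl (by simp)), by simp⟩ (by simp)

theorem aliceWins_two_two_one (n v : ℕ) (hv : 1 ≤ v) (h : 6 ≤ 2 * n + 2 + 2 * v) :
    AliceWins {2, 2, 1} ((2 * v) ::ₘ .replicate (2 * n + 1) 1) := by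
  obtain rfl | hv₂ : v = 1 ∨ 2 ≤ v := by omega
  · obtain rfl | ⟨n, rfl⟩ : n = 1 ∨ ∃ j, n = j + 2 := by
      obtain rfl | hn : n = 1 ∨ 2 ≤ n := by omega
      · exact .inl rfl
      · exact .inr ⟨n - 2, by omega⟩
    · refine .redOver 2 {2, 1} (.replicate 3 1) rfl rfl ?_
      rw [show ((2 + 2) ::ₘ {2, 1} : Multiset ℕ) = {1, 2, 4} by decide]
      exact bobLoses_one_two_four
    · refine .red 2 2 {1} rfl ?_
      rw [show ((2 + 2) ::ₘ {1} : Multiset ℕ) = {1, 4} by decide]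
      exact bobLoses_one_four n
  · by_cases hnv : n = 0 ∧ v = 2
    · obtain ⟨rfl, rfl⟩ := hnv
      refine .redOver 1 {2, 2} {4} (by decide) (by decide) ?_
      refine .of_moves (fun R' hR => ?_) (fun B' hB => absurd hB not_merge_singleton) (by simp)
      have : R' = {4, 2} := by
        rcases hR.of_triple with rfl | rfl | rfl <;> decide
      rw [this]
      exact .red 4 2 0 rfl (bobLoses_singleton 0 _ (by simp)
        ⟨by simp, .inr (.inl (by simp)), by simp⟩ (by simp))
    · refine .red 2 1 {2} (by decide) ?_
      refine bobLoses_pair (by simp) (by simp) n _ (by simp)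
        ⟨by simp; omega, .inl (by decide), ?_⟩ ?_ ?_ ?_
      all_goals simp; omega

theorem bobLoses_two_one_one (n : ℕ) : ∀ v, 1 ≤ v → 6 ≤ 2 * n + 2 * v →
    BobLoses {2, 1, 1} ((2 * v) ::ₘ .replicate (2 * n) 1) := by
  induction n with
  | zero =>
    intro v hv h
    have h₄ : BobLoses {4} ((2 * v) ::ₘ .replicate (2 * 0) 1) :=
      bobLoses_singleton 0 _ (by simp)
        ⟨by simp; omega, .inr (.inr ⟨2 * v, by simp, by omega⟩), by simp; omega⟩ (by simp; omega)
    refine .of_moves (fun R' hR => ?_) (fun B' hB => ?_) (fun a ha haB => ?_)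
    · rcases hR.of_triple with rfl | rfl | rfl
      · exact .red 3 1 0 rfl h₄
      · exact .red 3 1 0 rfl h₄
      · exact .red 2 2 0 rfl h₄
    · rcases hB.of_cons_replicate_one with ⟨j, hj, -⟩ | ⟨j, hj, -⟩ <;> omega
    · simp at ha haB
      omega
  | succ n ih =>
    intro v hv h
    have h₁ : (2 * v ::ₘ .replicate (2 * (n + 1)) 1 : Multiset ℕ) =
        1 ::ₘ (2 * v) ::ₘ .replicate (2 * n + 1) 1 := by
      rw [Multiset.cons_swap, ← Multiset.replicate_succ]
      rfl
    have h₂₂ := bobLoses_two_two n v hv (by omega)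
    have h₃ := bobLoses_three n v hv
    refine .of_moves (fun R' hR => ?_) (fun B' hB => ?_) (fun a ha haB => ?_)
    · rcases hR.of_triple with rfl | rfl | rfl
      · exact .blueOver 1 {3} _ (by decide) h₁ h₃
      · exact .blueOver 1 {3} _ (by decide) h₁ h₃
      · exact .blue (2 * v) 1 (.replicate (2 * n + 1) 1) rfl h₂₂
    · rcases hB.of_cons_replicate_one with ⟨j, hj, rfl⟩ | ⟨j, hj, rfl⟩
      · obtain rfl : j = 2 * n + 1 := by omega
        exact .red 1 1 {2} (by decide) h₂₂
      · obtain rfl : j = 2 * n := by omega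
        refine .blue (2 * v) 2 _ (Multiset.cons_swap _ _ _) (ih (v + 1) (by omega) (by omega))
    · obtain rfl | ⟨rfl, rfl⟩ : a = 1 ∨ a = 2 ∧ v = 1 := by
        simp [Multiset.mem_replicate] at ha haB
        omega
      · rw [h₁, Multiset.erase_cons_head]
        exact ⟨aliceWins_two_two_one n v hv (by omega), .red 2 1 0 (by decide) h₃⟩
      · obtain ⟨n, rfl⟩ : ∃ j, n = j + 1 := ⟨n - 1, by omega⟩
        rw [mul_one, Multiset.erase_cons_head]
        constructor
        · rcases n with _ | n
          · refine .red 1 1 {4} (by decide) ?_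
            exact bobLoses_pair (by simp) (by simp) 1 _ (by simp)
              ⟨by simp, .inr (.inl (by simp)), by simp⟩ (by simp) (by simp) (by simp)
          · exact .blueOver 1 {1, 4} (.replicate (2 * n + 5) 1) (by decide)
              (Multiset.replicate_succ _ _) (bobLoses_one_four n)
        · refine .red 1 1 0 (by decide) (bobLoses_singleton (n + 2) _ (by simp)
            ⟨by simp; omega, .inr (.inr ⟨4, by simp, by omega⟩), by simp⟩ (by simp))

theorem heights_replicate_self {c : Bool} (n : ℕ) :
    heights c (.replicate n [c]) = .replicate n 1 := by
  induction n with
  | zero => rfl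
  | succ n ih => rw [Multiset.replicate_succ, heights_cons_self _ rfl, ih]; rfl

theorem heights_replicate_ne {c d : Bool} (h : d ≠ c) (n : ℕ) :
    heights c (.replicate n [d]) = 0 := by
  induction n with
  | zero => rfl
  | succ n ih => rw [Multiset.replicate_succ, heights_cons_ne _ (by simpa using h), ih]

theorem heights_add (c : Bool) (P Q : Position) : heights c (P + Q) = heights c P + heights c Q := by
  simp [heights]

/-- Every position `⟨4, k; ; 2v⟩` (four red singletons, `k ≥ 4` even blue
singletons, no red stack of height at least two, and one blue stack of height
`2v` with `v ≥ 1`) is a first-player win. -/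
theorem position_three (k v : ℕ) (B : Stack)
    (hk : 4 ≤ k) (hkeven : Even k) (hv : 1 ≤ v)
    (hB : B.head? = some false) (hBlen : B.length = 2 * v) :
    FirstWin (B ::ₘ
      (Multiset.replicate 4 [true] + Multiset.replicate k [false])) := by
  refine (firstWinAux_of_heights _ _ le_rfl).1 ?_
  rw [heights_cons_ne _ (by simp [hB]), heights_cons_self _ hB, heights_add, heights_add,
    heights_replicate_self, heights_replicate_self, heights_replicate_ne (by simp),
    heights_replicate_ne (by simp), add_zero, zero_add, hBlen]
  obtain ⟨n, rfl⟩ := hkeven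
  rw [← two_mul]
  exact .red 1 1 {1, 1} rfl (bobLoses_two_one_one n v hv (by omega))
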